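/- arXiv:2107.10943 — 2 statements merged into one kernel-verified Lean document; each statement's English description precedes it below -/
import Mathlib

section
/- Let ρ : ℝ × ℝ³ → ℝ and J : ℝ × ℝ³ → ℝ³ be smooth and satisfy the continuity equation ∂ρ/∂t + div J = 0. Assume (ρ, J) is non-radiating: for every v ∈ ℝ³ with |v| < c there exist smooth E', B' : ℝ × ℝ³ → ℝ³ such that (ρ'_v, J'_v, E', B') satisfies Maxwell's equations and B' = 0 identically. Then at every point ∇ρ + (1/c²) ∂J/∂t = 0 and curl J = 0, and ρ and J satisfy the wave equations □²ρ = 0 and □²J = 0. -/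
noncomputable section

open Real MeasureTheory Filter

/-- Physical space `ℝ³`. -/
abbrev V3 : Type := Fin 3 → ℝ

/-- Partial derivative with respect to the time variable. -/
def ptd {E : Type} [NormedAddCommGroup E] [NormedSpace ℝ E]
    (f : ℝ × V3 → E) : ℝ × V3 → E :=
  fun p => deriv (fun s => f (s, p.2)) p.1

/-- Partial derivative in the `i`-th spatial direction. -/
def pxd {E : Type} [NormedAddCommGroup E] [NormedSpace ℝ E]
    (i : Fin 3) (f : ℝ × V3 → E) : ℝ × V3 → E :=
  fun p => fderiv ℝ (fun y => f (p.1, y)) p.2 (Pi.single i (1 : ℝ))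

/-- Spatial Laplacian. -/
def lap {E : Type} [NormedAddCommGroup E] [NormedSpace ℝ E]
    (f : ℝ × V3 → E) : ℝ × V3 → E :=
  fun p => ∑ i : Fin 3, pxd i (pxd i f) p

/-- Spatial divergence of a vector field. -/
def divg (F : ℝ × V3 → V3) : ℝ × V3 → ℝ :=
  fun p => ∑ i : Fin 3, pxd i (fun q => F q i) p

/-- Spatial curl of a vector field. -/
def curl (F : ℝ × V3 → V3) : ℝ × V3 → V3 :=
  fun p => ![pxd 1 (fun q => F q 2) p - pxd 2 (fun q => F q 1) p,
             pxd 2 (fun q => F q 0) p - pxd 0 (fun q => F q 2) p,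
             pxd 0 (fun q => F q 1) p - pxd 1 (fun q => F q 0) p]

/-- Spatial gradient of a scalar field. -/
def grad (f : ℝ × V3 → ℝ) : ℝ × V3 → V3 :=
  fun p i => pxd i f p

/-- The d'Alembertian `□² = Δ - μ₀ε₀ ∂²/∂t²`. -/
def box (μ₀ ε₀ : ℝ) {E : Type} [NormedAddCommGroup E] [NormedSpace ℝ E]
    (f : ℝ × V3 → E) : ℝ × V3 → E :=
  fun p => lap f p - (μ₀ * ε₀) • ptd (ptd f) p

/-- Maxwell's equations for charge `ρ`, current `J` and fields `E`, `B`. -/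
def Maxwell (ε₀ μ₀ : ℝ) (ρ : ℝ × V3 → ℝ) (J E B : ℝ × V3 → V3) : Prop :=
  ∀ p : ℝ × V3,
    divg E p = ρ p / ε₀ ∧ divg B p = 0 ∧
    curl E p = -(ptd B p) ∧
    curl B p = μ₀ • J p + (μ₀ * ε₀) • ptd E p

/-- `f` is Schwartz in the spatial variable, locally uniformly in time. -/
def SchwartzLocUnif {E : Type} [NormedAddCommGroup E] [NormedSpace ℝ E]
    (f : ℝ × V3 → E) : Prop :=
  ∀ (α β : Fin 3 → ℕ) (j : ℕ) (R : ℝ), ∃ C : ℝ, ∀ p : ℝ × V3, |p.1| ≤ R →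
    |∏ i : Fin 3, p.2 i ^ α i| *
      ‖(ptd^[j] ((pxd 0)^[β 0] ((pxd 1)^[β 1] ((pxd 2)^[β 2] f)))) p‖ ≤ C

/-- Euclidean norm on `ℝ³`. -/
def norm3 (x : V3) : ℝ := Real.sqrt (∑ i : Fin 3, x i ^ 2)

/-- Dot product on `ℝ³`. -/
def dot3 (x y : V3) : ℝ := ∑ i : Fin 3, x i * y i

/-- Cross product on `ℝ³`. -/
def cross3 (a b : V3) : V3 :=
  ![a 1 * b 2 - a 2 * b 1, a 2 * b 0 - a 0 * b 2, a 0 * b 1 - a 1 * b 0]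

/-- The Lorentz factor `γ_v`. -/
def gam (c : ℝ) (v : V3) : ℝ := 1 / Real.sqrt (1 - norm3 v ^ 2 / c ^ 2)

/-- The Lorentz boost `Λ_v` with velocity `v`. -/
def boost (c : ℝ) (v : V3) (p : ℝ × V3) : ℝ × V3 :=
  (gam c v * (p.1 - dot3 v p.2 / c ^ 2),
   p.2 + ((gam c v - 1) * dot3 v p.2 / norm3 v ^ 2 - gam c v * p.1) • v)

/-- Transformed charge `ρ'_v`, i.e. the function with
`ρ'_v (Λ_v p) = γ_v (ρ p - v·J p / c²)`. -/
def rhoTr (c : ℝ) (v : V3) (ρ : ℝ × V3 → ℝ) (J : ℝ × V3 → V3) : ℝ × V3 → ℝ :=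
  fun p => gam c v * (ρ (boost c (-v) p) - dot3 v (J (boost c (-v) p)) / c ^ 2)

/-- Transformed current `J'_v`, i.e. the function with
`J'_v (Λ_v p) = J p + ((γ_v - 1)(v·J p)/|v|² - γ_v ρ p) v`. -/
def JTr (c : ℝ) (v : V3) (ρ : ℝ × V3 → ℝ) (J : ℝ × V3 → V3) : ℝ × V3 → V3 :=
  fun p => J (boost c (-v) p) +
    ((gam c v - 1) * dot3 v (J (boost c (-v) p)) / norm3 v ^ 2
      - gam c v * ρ (boost c (-v) p)) • v

/-- Transformed electric field `E''_v`, i.e. the function with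
`E''_v (Λ_v p) = E_∥ p + γ_v E_⊥ p`. -/
def ETr (c : ℝ) (v : V3) (E : ℝ × V3 → V3) : ℝ × V3 → V3 :=
  fun p =>
    (dot3 (E (boost c (-v) p)) v / norm3 v ^ 2) • v +
    gam c v • (E (boost c (-v) p) - (dot3 (E (boost c (-v) p)) v / norm3 v ^ 2) • v)

/-- Spatial gradient of a complex scalar field. -/
def gradC (f : ℝ × V3 → ℂ) : ℝ × V3 → Fin 3 → ℂ :=
  fun p i => pxd i f p

/-- Spatial divergence of a complex vector field. -/
def divgC (F : ℝ × V3 → Fin 3 → ℂ) : ℝ × V3 → ℂ :=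
  fun p => ∑ i : Fin 3, pxd i (fun q => F q i) p

section Derivatives

variable {E : Type} [NormedAddCommGroup E] [NormedSpace ℝ E]

/-- The constant time direction in `ℝ × ℝ³`. -/
abbrev timeDir : ℝ × V3 := (1, 0)

/-- The `i`-th constant spatial direction in `ℝ × ℝ³`. -/
abbrev spaceDir (i : Fin 3) : ℝ × V3 := (0, Pi.single i 1)

theorem ptd_eq_fderiv {f : ℝ × V3 → E} (hf : Differentiable ℝ f) :
    ptd f = fun p => fderiv ℝ f p timeDir := by
  funext p
  have h1 : HasDerivAt (fun s : ℝ => (s, p.2)) timeDir p.1 :=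
    (hasDerivAt_id p.1).prodMk (hasDerivAt_const p.1 p.2)
  exact ((hf p).hasFDerivAt.comp_hasDerivAt p.1 h1).deriv

theorem pxd_eq_fderiv (i : Fin 3) {f : ℝ × V3 → E} (hf : Differentiable ℝ f) :
    pxd i f = fun p => fderiv ℝ f p (spaceDir i) := by
  funext p
  have h1 : HasFDerivAt (fun y : V3 => (p.1, y)) (ContinuousLinearMap.inr ℝ ℝ V3) p.2 := by
    simpa using hasFDerivAt_prodMk_right p.1 p.2
  have h2 : HasFDerivAt (fun y : V3 => f (p.1, y))
      ((fderiv ℝ f p).comp (ContinuousLinearMap.inr ℝ ℝ V3)) p.2 :=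
    (hf p).hasFDerivAt.comp p.2 h1
  simp [pxd, h2.fderiv]

theorem ContDiff.fderiv_apply_const {f : ℝ × V3 → E} (hf : ContDiff ℝ (⊤ : ℕ∞) f) (u : ℝ × V3) :
    ContDiff ℝ (⊤ : ℕ∞) (fun p => fderiv ℝ f p u) :=
  (hf.fderiv_right (m := (⊤ : ℕ∞)) (by simp)).clm_apply contDiff_const

theorem fderiv_apply_comm {f : ℝ × V3 → E} (hf : ContDiff ℝ (⊤ : ℕ∞) f) (u w p : ℝ × V3) :
    fderiv ℝ (fun q => fderiv ℝ f q u) p w = fderiv ℝ (fun q => fderiv ℝ f q w) p u := by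
  have hd : DifferentiableAt ℝ (fderiv ℝ f) p :=
    (hf.fderiv_right (m := (⊤ : ℕ∞)) (by simp)).differentiable (by simp) p
  have key : ∀ u w : ℝ × V3, fderiv ℝ (fun q => fderiv ℝ f q u) p w =
      fderiv ℝ (fderiv ℝ f) p w u := fun u w => by
    rw [fderiv_clm_apply hd (differentiableAt_const u)]
    simp
  rw [key, key]
  exact (hf.contDiffAt.isSymmSndFDerivAt (by simpa using WithTop.coe_le_coe.2 (le_top : (2 : ℕ∞) ≤ ⊤))).eq w u

theorem ContDiff.ptd {f : ℝ × V3 → E} (hf : ContDiff ℝ (⊤ : ℕ∞) f) :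
    ContDiff ℝ (⊤ : ℕ∞) (ptd f) := by
  rw [ptd_eq_fderiv (hf.differentiable (by simp))]
  exact hf.fderiv_apply_const _

theorem ContDiff.pxd {f : ℝ × V3 → E} (hf : ContDiff ℝ (⊤ : ℕ∞) f) (i : Fin 3) :
    ContDiff ℝ (⊤ : ℕ∞) (pxd i f) := by
  rw [pxd_eq_fderiv i (hf.differentiable (by simp))]
  exact hf.fderiv_apply_const _

theorem pxd_ptd_comm {f : ℝ × V3 → E} (hf : ContDiff ℝ (⊤ : ℕ∞) f) (i : Fin 3) :
    pxd i (ptd f) = ptd (pxd i f) := by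
  rw [pxd_eq_fderiv i (hf.ptd.differentiable (by simp)),
    ptd_eq_fderiv ((hf.pxd i).differentiable (by simp)),
    ptd_eq_fderiv (hf.differentiable (by simp)), pxd_eq_fderiv i (hf.differentiable (by simp))]
  exact funext fun p => fderiv_apply_comm hf _ _ p

theorem pxd_pxd_comm {f : ℝ × V3 → E} (hf : ContDiff ℝ (⊤ : ℕ∞) f) (i j : Fin 3) :
    pxd i (pxd j f) = pxd j (pxd i f) := by
  rw [pxd_eq_fderiv i ((hf.pxd j).differentiable (by simp)),
    pxd_eq_fderiv j ((hf.pxd i).differentiable (by simp)),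
    pxd_eq_fderiv j (hf.differentiable (by simp)), pxd_eq_fderiv i (hf.differentiable (by simp))]
  exact funext fun p => fderiv_apply_comm hf _ _ p

theorem ptd_const_mul (a : ℝ) {f : ℝ × V3 → ℝ} (hf : Differentiable ℝ f) :
    ptd (fun q => a * f q) = fun p => a * ptd f p := by
  rw [ptd_eq_fderiv (hf.const_mul a), ptd_eq_fderiv hf]
  funext p
  rw [fderiv_const_mul (hf p)]
  simp

theorem pxd_const_mul (i : Fin 3) (a : ℝ) {f : ℝ × V3 → ℝ} (hf : Differentiable ℝ f) :
    pxd i (fun q => a * f q) = fun p => a * pxd i f p := by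
  rw [pxd_eq_fderiv i (hf.const_mul a), pxd_eq_fderiv i hf]
  funext p
  rw [fderiv_const_mul (hf p)]
  simp

theorem ptd_apply {F : ℝ × V3 → V3} (hF : Differentiable ℝ F) (k : Fin 3) (p : ℝ × V3) :
    ptd F p k = ptd (fun q => F q k) p := by
  rw [ptd_eq_fderiv hF, ptd_eq_fderiv (f := fun q => F q k) (differentiable_pi.1 hF k)]
  beta_reduce
  rw [fderiv_apply (hF p)]
  rfl

theorem pxd_apply (i : Fin 3) {F : ℝ × V3 → V3} (hF : Differentiable ℝ F) (k : Fin 3)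
    (p : ℝ × V3) : pxd i F p k = pxd i (fun q => F q k) p := by
  rw [pxd_eq_fderiv i hF, pxd_eq_fderiv i (f := fun q => F q k) (differentiable_pi.1 hF k)]
  beta_reduce
  rw [fderiv_apply (hF p)]
  rfl

theorem ContDiff.component {F : ℝ × V3 → V3} (hF : ContDiff ℝ (⊤ : ℕ∞) F) (k : Fin 3) :
    ContDiff ℝ (⊤ : ℕ∞) (fun q => F q k) :=
  contDiff_pi.1 hF k

theorem curl_eq_zero_iff (F : ℝ × V3 → V3) (p : ℝ × V3) :
    curl F p = 0 ↔ ∀ i k, pxd i (fun q => F q k) p = pxd k (fun q => F q i) p := by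
  constructor
  · intro h
    have h0 := congrFun h 0
    have h1 := congrFun h 1
    have h2 := congrFun h 2
    simp only [curl, Matrix.cons_val, Pi.zero_apply] at h0 h1 h2
    intro i k
    fin_cases i <;> fin_cases k <;> simp <;> linarith
  · intro h
    funext k
    fin_cases k <;> simp [curl, h 1 2, h 2 0, h 0 1]

theorem box_apply (μ₀ ε₀ : ℝ) {F : ℝ × V3 → V3} (hF : ContDiff ℝ (⊤ : ℕ∞) F) (k : Fin 3)
    (p : ℝ × V3) : box μ₀ ε₀ F p k = box μ₀ ε₀ (fun q => F q k) p := by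
  have hd := hF.differentiable (by simp)
  have h1 : ∀ i, pxd i (pxd i F) p k = pxd i (pxd i (fun q => F q k)) p := fun i => by
    rw [pxd_apply i ((hF.pxd i).differentiable (by simp))]
    simp only [pxd_apply i hd]
  have h2 : ptd (ptd F) p k = ptd (ptd (fun q => F q k)) p := by
    rw [ptd_apply (hF.ptd.differentiable (by simp))]
    simp only [ptd_apply hd]
  simp [box, lap, h1, h2]

end Derivatives

/-- If Maxwell's equations have a solution with vanishing magnetic field, the current is
curl-free. -/
theorem Maxwell.pxd_current_symm {ε₀ μ₀ : ℝ} (hμ : μ₀ ≠ 0) {ρ : ℝ × V3 → ℝ}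
    {J E B : ℝ × V3 → V3} (hE : ContDiff ℝ (⊤ : ℕ∞) E) (h : Maxwell ε₀ μ₀ ρ J E B)
    (hB : ∀ p, B p = 0) (i k : Fin 3) (p : ℝ × V3) :
    pxd i (fun q => J q k) p = pxd k (fun q => J q i) p := by
  obtain rfl : B = fun _ => 0 := funext hB
  have hE_symm : ∀ i k, pxd i (fun q => E q k) = pxd k (fun q => E q i) := fun i k =>
    funext fun q => (curl_eq_zero_iff E q).1 (by simpa [ptd] using (h q).2.2.1) i k
  have hJ : ∀ k, (fun q => J q k) = fun q => -ε₀ * ptd (fun q => E q k) q := fun k => by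
    funext q
    have h0 : curl (fun _ : ℝ × V3 => (0 : V3)) q = 0 :=
      (curl_eq_zero_iff _ q).2 fun _ _ => by simp [pxd]
    have h1 := congrFun ((h q).2.2.2.symm.trans h0) k
    simp only [Pi.add_apply, Pi.smul_apply, smul_eq_mul, Pi.zero_apply,
      ptd_apply (hE.differentiable (by simp))] at h1
    refine mul_left_cancel₀ hμ ?_
    linarith
  rw [hJ, hJ, pxd_const_mul _ _ ((hE.component k).ptd.differentiable (by simp)),
    pxd_const_mul _ _ ((hE.component i).ptd.differentiable (by simp)),
    pxd_ptd_comm (hE.component k), pxd_ptd_comm (hE.component i), hE_symm]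

section AxisBoost

/-- The boost with velocity `-a` along the `j`-th axis, with `g` in the role of the Lorentz
factor. -/
def axisBoost (c a g : ℝ) (j : Fin 3) : (ℝ × V3) →L[ℝ] (ℝ × V3) :=
  LinearMap.toContinuousLinearMap
    { toFun := fun p => (g * (p.1 + a * p.2 j / c ^ 2),
        p.2 + ((g - 1) * p.2 j + g * a * p.1) • Pi.single j (1 : ℝ))
      map_add' := fun p q => by
        refine Prod.ext ?_ (funext fun k => ?_)
        · simp; ring
        · simp; ring
      map_smul' := fun r p => by
        refine Prod.ext ?_ (funext fun k => ?_)
        · simp; ring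
        · simp; ring }

theorem axisBoost_apply (c a g : ℝ) (j : Fin 3) (p : ℝ × V3) :
    axisBoost c a g j p = (g * (p.1 + a * p.2 j / c ^ 2),
      p.2 + ((g - 1) * p.2 j + g * a * p.1) • Pi.single j (1 : ℝ)) := rfl

theorem axisBoost_surjective {c a g : ℝ} (hc : c ≠ 0) (hg : g ^ 2 * (1 - a ^ 2 / c ^ 2) = 1)
    (j : Fin 3) : Function.Surjective (axisBoost c a g j) := by
  intro q
  refine ⟨axisBoost c (-a) g j q, ?_⟩
  field_simp at hg
  simp only [axisBoost_apply]
  refine Prod.ext ?_ (funext fun k => ?_)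
  · simp
    field_simp
    linear_combination q.1 * hg
  · by_cases hk : k = j
    · subst hk
      simp
      field_simp
      linear_combination q.2 k * hg
    · simp [hk]

theorem norm3_single (a : ℝ) (j : Fin 3) : norm3 (Pi.single j a) = |a| := by
  rw [norm3, ← Real.sqrt_sq_eq_abs]
  congr 1
  rw [Finset.sum_eq_single j] <;> simp +contextual

theorem dot3_single (a : ℝ) (j : Fin 3) (x : V3) : dot3 (Pi.single j a) x = a * x j := by
  rw [dot3, Finset.sum_eq_single j] <;> simp +contextual

theorem gam_neg (c : ℝ) (v : V3) : gam c (-v) = gam c v := by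
  simp [gam, norm3]

theorem gam_zero (c : ℝ) : gam c 0 = 1 := by
  simp [gam, norm3]

theorem gam_single_sq {c a : ℝ} (h : |a| < c) (j : Fin 3) :
    gam c (Pi.single j a) ^ 2 * (1 - a ^ 2 / c ^ 2) = 1 := by
  have hc : 0 < c := (abs_nonneg a).trans_lt h
  have hpos : 0 < 1 - a ^ 2 / c ^ 2 := by
    rw [sub_pos, div_lt_one (by positivity)]
    exact sq_lt_sq.2 (by rwa [abs_of_pos hc])
  rw [gam, norm3_single, sq_abs, div_pow, Real.sq_sqrt hpos.le, one_pow,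
    one_div_mul_cancel hpos.ne']

theorem boost_neg_single (c a : ℝ) (j : Fin 3) (p : ℝ × V3) :
    boost c (-Pi.single j a) p = axisBoost c a (gam c (Pi.single j a)) j p := by
  rw [boost, gam_neg, axisBoost_apply, ← Pi.single_neg, dot3_single, norm3_single, abs_neg, sq_abs]
  refine Prod.ext ?_ (funext fun k => ?_)
  · simp only
    ring
  · rcases eq_or_ne a 0 with rfl | ha
    · simp [gam_zero]
    · by_cases hk : k = j
      · subst hk
        simp
        field_simp
        ring
      · simp [hk]

theorem JTr_single_self (c a : ℝ) (j : Fin 3) (ρ : ℝ × V3 → ℝ) (J : ℝ × V3 → V3) :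
    (fun p => JTr c (Pi.single j a) ρ J p j) = fun p =>
      gam c (Pi.single j a) * (J (axisBoost c a (gam c (Pi.single j a)) j p) j -
        a * ρ (axisBoost c a (gam c (Pi.single j a)) j p)) := by
  funext p
  rcases eq_or_ne a 0 with rfl | ha
  · have hb := boost_neg_single c 0 j p
    simp only [Pi.single_zero, neg_zero, gam_zero] at hb ⊢
    simp [JTr, gam_zero, hb]
  · simp only [JTr, boost_neg_single, dot3_single, norm3_single, sq_abs, Pi.add_apply,
      Pi.smul_apply, Pi.single_eq_same, smul_eq_mul]
    field_simp
    ring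

theorem JTr_single_of_ne (c a : ℝ) {i j : Fin 3} (hij : i ≠ j) (ρ : ℝ × V3 → ℝ)
    (J : ℝ × V3 → V3) :
    (fun p => JTr c (Pi.single j a) ρ J p i) =
      fun p => J (axisBoost c a (gam c (Pi.single j a)) j p) i := by
  funext p
  simp [JTr, boost_neg_single, hij]

theorem axisBoost_spaceDir_self (c a g : ℝ) (j : Fin 3) :
    axisBoost c a g j (spaceDir j) = g • spaceDir j + (g * (a / c ^ 2)) • timeDir := by
  rw [axisBoost_apply]
  refine Prod.ext ?_ (funext fun k => ?_)
  · simp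
  · by_cases hk : k = j
    · subst hk
      simp
    · simp [hk]

theorem axisBoost_spaceDir_of_ne (c a g : ℝ) {i j : Fin 3} (hij : i ≠ j) :
    axisBoost c a g j (spaceDir i) = spaceDir i := by
  rw [axisBoost_apply]
  simp [hij.symm]

theorem pxd_comp_axisBoost (c a g : ℝ) (i j : Fin 3) {f : ℝ × V3 → ℝ} (hf : Differentiable ℝ f)
    (p : ℝ × V3) : pxd i (fun q => f (axisBoost c a g j q)) p =
      fderiv ℝ f (axisBoost c a g j p) (axisBoost c a g j (spaceDir i)) := by
  have hd : Differentiable ℝ (fun q => f (axisBoost c a g j q)) :=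
    hf.comp (axisBoost c a g j).differentiable
  rw [pxd_eq_fderiv i hd]
  exact congrArg (fun T : (ℝ × V3) →L[ℝ] ℝ => T (spaceDir i))
    ((hf _).hasFDerivAt.comp p (axisBoost c a g j).hasFDerivAt).fderiv

/-- Curl-freeness of the current in a frame moving along the `j`-th axis, pulled back to the
original frame. -/
theorem pxd_add_eq_of_JTr_symm {c a : ℝ} (hac : |a| < c) {ρ : ℝ × V3 → ℝ} {J : ℝ × V3 → V3}
    (hρ : Differentiable ℝ ρ) (hJ : Differentiable ℝ J) {i j : Fin 3} (hij : i ≠ j)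
    (h : ∀ p, pxd j (fun q => JTr c (Pi.single j a) ρ J q i) p =
      pxd i (fun q => JTr c (Pi.single j a) ρ J q j) p) (p : ℝ × V3) :
    pxd j (fun q => J q i) p + a / c ^ 2 * ptd (fun q => J q i) p =
      pxd i (fun q => J q j) p - a * pxd i ρ p := by
  have hc : c ≠ 0 := ((abs_nonneg a).trans_lt hac).ne'
  have hg := gam_single_sq hac j
  have hJk : ∀ k, Differentiable ℝ (fun q => J q k) := differentiable_pi.1 hJ
  have hf : Differentiable ℝ (fun q => J q j - a * ρ q) := (hJk j).sub (hρ.const_mul a)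
  obtain ⟨q, rfl⟩ := axisBoost_surjective hc hg j p
  have hq := h q
  rw [JTr_single_self, JTr_single_of_ne _ _ hij] at hq
  set g := gam c (Pi.single j a)
  have hg0 : g ≠ 0 := by
    rintro h0
    simp [h0] at hg
  rw [pxd_const_mul i g (f := fun q => J (axisBoost c a g j q) j - a * ρ (axisBoost c a g j q))
      (hf.comp (axisBoost c a g j).differentiable),
    pxd_comp_axisBoost _ _ _ _ _ (hJk i)] at hq
  beta_reduce at hq
  rw [pxd_comp_axisBoost _ _ _ _ _ hf, axisBoost_spaceDir_self,
    axisBoost_spaceDir_of_ne _ _ _ hij,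
    fderiv_fun_sub (hJk j _) ((hρ _).const_mul a), fderiv_const_mul (hρ _)] at hq
  simp only [map_add, map_smul, smul_eq_mul, sub_apply, smul_apply] at hq
  rw [pxd_eq_fderiv j (hJk i), ptd_eq_fderiv (hJk i), pxd_eq_fderiv i (hJk j),
    pxd_eq_fderiv i hρ]
  refine mul_left_cancel₀ hg0 ?_
  linear_combination hq

end AxisBoost

section WaveEquations

variable {μ₀ ε₀ : ℝ} {ρ : ℝ × V3 → ℝ} {J : ℝ × V3 → V3}

theorem box_charge_eq_zero (hJ : ContDiff ℝ (⊤ : ℕ∞) J)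
    (hcont : ∀ p, ptd ρ p = -∑ i, pxd i (fun q => J q i) p)
    (hgrad : ∀ i p, pxd i ρ p = -(μ₀ * ε₀) * ptd (fun q => J q i) p) (p : ℝ × V3) :
    box μ₀ ε₀ ρ p = 0 := by
  have h1 : ∀ i, pxd i (pxd i ρ) p = -(μ₀ * ε₀) * ptd (pxd i (fun q => J q i)) p := fun i => by
    rw [funext (hgrad i), pxd_const_mul i _ ((hJ.component i).ptd.differentiable (by simp)),
      pxd_ptd_comm (hJ.component i)]
  have hd : ∀ i, Differentiable ℝ (pxd i (fun q => J q i)) := fun i =>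
    ((hJ.component i).pxd i).differentiable (by simp)
  have h2 : ptd (ptd ρ) p = -∑ i, ptd (pxd i (fun q => J q i)) p := by
    rw [funext hcont, ptd_eq_fderiv (Differentiable.fun_sum fun i _ => hd i).fun_neg]
    simp only [ptd_eq_fderiv (hd _)]
    rw [fderiv_fun_neg, fderiv_fun_sum fun i _ => hd i p]
    simp
  simp only [box, lap, h1, h2, ← Finset.mul_sum, smul_eq_mul]
  ring

theorem box_current_eq_zero (hρ : ContDiff ℝ (⊤ : ℕ∞) ρ) (hJ : ContDiff ℝ (⊤ : ℕ∞) J)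
    (hcont : ∀ p, ptd ρ p = -∑ i, pxd i (fun q => J q i) p)
    (hgrad : ∀ i p, pxd i ρ p = -(μ₀ * ε₀) * ptd (fun q => J q i) p)
    (hcurl : ∀ i k p, pxd i (fun q => J q k) p = pxd k (fun q => J q i) p) (p : ℝ × V3) :
    box μ₀ ε₀ J p = 0 := by
  funext k
  rw [box_apply μ₀ ε₀ hJ]
  have hd : ∀ i, Differentiable ℝ (pxd i (fun q => J q i)) := fun i =>
    ((hJ.component i).pxd i).differentiable (by simp)
  have h1 : ∀ i, pxd i (pxd i (fun q => J q k)) p = pxd k (pxd i (fun q => J q i)) p := fun i => by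
    rw [funext (hcurl i k), pxd_pxd_comm (hJ.component i)]
  have h2 : pxd k (ptd ρ) p = -∑ i, pxd k (pxd i (fun q => J q i)) p := by
    rw [funext hcont, pxd_eq_fderiv k (Differentiable.fun_sum fun i _ => hd i).fun_neg]
    simp only [pxd_eq_fderiv k (hd _)]
    rw [fderiv_fun_neg, fderiv_fun_sum fun i _ => hd i p]
    simp
  rw [pxd_ptd_comm hρ, funext (hgrad k),
    ptd_const_mul _ ((hJ.component k).ptd.differentiable (by simp))] at h2
  simp only [box, lap, h1, smul_eq_mul, Pi.zero_apply]
  linarith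

end WaveEquations

/-- a non-radiating charge/current pair (in every inertial frame
the transformed pair extends to a Maxwell solution with vanishing magnetic
field) satisfies `∇ρ + (1/c²)∂J/∂t = 0`, `curl J = 0`, and the wave equations
`□²ρ = 0`, `□²J = 0`. -/
theorem stmt_13 (ε₀ μ₀ c : ℝ) (hε : 0 < ε₀) (hμ : 0 < μ₀)
    (hc : c = 1 / Real.sqrt (μ₀ * ε₀))
    (ρ : ℝ × V3 → ℝ) (J : ℝ × V3 → V3)
    (hρ : ContDiff ℝ (⊤ : ℕ∞) ρ) (hJ : ContDiff ℝ (⊤ : ℕ∞) J)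
    (hcont : ∀ p : ℝ × V3, ptd ρ p + divg J p = 0)
    (hnr : ∀ v : V3, norm3 v < c →
      ∃ E' B' : ℝ × V3 → V3,
        ContDiff ℝ (⊤ : ℕ∞) E' ∧ ContDiff ℝ (⊤ : ℕ∞) B' ∧
        Maxwell ε₀ μ₀ (rhoTr c v ρ J) (JTr c v ρ J) E' B' ∧
        ∀ p : ℝ × V3, B' p = 0) :
    (∀ p : ℝ × V3, grad ρ p + (c ^ 2)⁻¹ • ptd J p = 0) ∧
    (∀ p : ℝ × V3, curl J p = 0) ∧
    (∀ p : ℝ × V3, box μ₀ ε₀ ρ p = 0) ∧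
    (∀ p : ℝ × V3, box μ₀ ε₀ J p = 0) := by
  have hc_pos : 0 < c := by rw [hc]; positivity
  have hc_sq : (c ^ 2)⁻¹ = μ₀ * ε₀ := by
    rw [hc, div_pow, Real.sq_sqrt (by positivity)]
    simp
  have hframe : ∀ {a : ℝ}, |a| < c → ∀ {i j : Fin 3}, i ≠ j → ∀ p,
      pxd j (fun q => J q i) p + a / c ^ 2 * ptd (fun q => J q i) p =
        pxd i (fun q => J q j) p - a * pxd i ρ p := by
    intro a ha i j hij
    obtain ⟨E', B', hE', -, hM, hB'⟩ := hnr (Pi.single j a) (by rwa [norm3_single])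
    exact pxd_add_eq_of_JTr_symm ha (hρ.differentiable (by simp)) (hJ.differentiable (by simp))
      hij (hM.pxd_current_symm hμ.ne' hE' hB' j i)
  have hcurl : ∀ i k p, pxd i (fun q => J q k) p = pxd k (fun q => J q i) p := by
    intro i k p
    rcases eq_or_ne i k with rfl | hik
    · rfl
    · simpa using hframe (a := 0) (by simpa using hc_pos) hik.symm p
  have hgrad : ∀ i p, pxd i ρ p = -(μ₀ * ε₀) * ptd (fun q => J q i) p := by
    intro i p
    obtain ⟨j, hij⟩ := exists_ne i
    have hlt : |c / 2| < c := by
      rw [abs_of_pos (by positivity)]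
      linarith
    have h := hframe hlt hij.symm p
    rw [hcurl j i p, div_eq_mul_inv _ (c ^ 2), hc_sq] at h
    refine mul_left_cancel₀ (half_pos hc_pos).ne' ?_
    linear_combination h
  have hdiv : ∀ p, ptd ρ p = -∑ i, pxd i (fun q => J q i) p := fun p =>
    eq_neg_of_add_eq_zero_left (hcont p)
  refine ⟨fun p => funext fun k => ?_, fun p => (curl_eq_zero_iff J p).2 fun i k => hcurl i k p,
    box_charge_eq_zero hJ hdiv hgrad, box_current_eq_zero hρ hJ hdiv hgrad hcurl⟩
  simp only [grad, Pi.add_apply, Pi.smul_apply, smul_eq_mul, Pi.zero_apply, hc_sq,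
    ptd_apply (hJ.differentiable (by simp)), hgrad]
  ring
end
end

section
/- With ρ and J given by the plane-wave representation with Schwartz coefficients f, g, F, G, assume that at every point of ℝ × ℝ³ both the continuity equation ∂ρ/∂t + div J = 0 and the relation ∇ρ + (1/c²) ∂J/∂t = 0 hold. If moreover J is tangential, i.e. x·J(t, x) = 0 for all (t, x) ∈ ℝ × ℝ³, then the pair is trivial: f = g = 0, F = G = 0, and hence ρ = 0 and J = 0 identically. -/
noncomputable section

open Real MeasureTheory Filter

/-- Scalar plane-wave representation
`ρ(t,x) = ∫ f(k) e^{i(k·x - c|k|t)} dk + ∫ g(k) e^{i(k·x + c|k|t)} dk`. -/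
def pwScalar (c : ℝ) (f g : V3 → ℂ) : ℝ × V3 → ℂ :=
  fun p =>
    (∫ k : V3, f k * Complex.exp (Complex.I * ((dot3 k p.2 - c * norm3 k * p.1 : ℝ) : ℂ))) +
    (∫ k : V3, g k * Complex.exp (Complex.I * ((dot3 k p.2 + c * norm3 k * p.1 : ℝ) : ℂ)))

/-- Vector plane-wave representation
`J(t,x) = ∫ F(k) e^{i(k·x - c|k|t)} dk + ∫ G(k) e^{i(k·x + c|k|t)} dk`. -/
def pwVec (c : ℝ) (F G : V3 → Fin 3 → ℂ) : ℝ × V3 → Fin 3 → ℂ :=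
  fun p =>
    (∫ k : V3, Complex.exp (Complex.I * ((dot3 k p.2 - c * norm3 k * p.1 : ℝ) : ℂ)) • F k) +
    (∫ k : V3, Complex.exp (Complex.I * ((dot3 k p.2 + c * norm3 k * p.1 : ℝ) : ℂ)) • G k)

lemma dot3_smul_right (a : ℝ) (x y : V3) : dot3 x (a • y) = a * dot3 x y := by
  simp only [dot3, Finset.mul_sum, Pi.smul_apply, smul_eq_mul, mul_left_comm]

lemma continuous_norm3 : Continuous norm3 := by
  unfold norm3; fun_prop

lemma norm3_nonneg (k : V3) : 0 ≤ norm3 k := Real.sqrt_nonneg _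

lemma norm3_le (k : V3) : norm3 k ≤ 2 * ‖k‖ := by
  refine Real.sqrt_le_iff.2 ⟨by positivity, ?_⟩
  have h : ∀ i, k i ^ 2 ≤ ‖k‖ ^ 2 := fun i => by
    rw [← sq_abs (k i)]
    have := norm_le_pi_norm k i
    rw [Real.norm_eq_abs] at this
    gcongr
  rw [Fin.sum_univ_three]
  nlinarith [h 0, h 1, h 2, sq_nonneg ‖k‖]

lemma norm3_pos {k : V3} (hk : k ≠ 0) : 0 < norm3 k := by
  refine Real.sqrt_pos.2 ?_
  obtain ⟨i, hi⟩ := Function.ne_iff.1 hk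
  exact Finset.sum_pos' (fun j _ => sq_nonneg _) ⟨i, Finset.mem_univ _, by
    have : k i ≠ 0 := hi
    positivity⟩

/-- The dot product with a fixed vector, as a continuous linear form. -/
def dotCLM (k : V3) : V3 →L[ℝ] ℝ := ∑ i, k i • ContinuousLinearMap.proj (R := ℝ) i

lemma dotCLM_apply (k x : V3) : dotCLM k x = dot3 k x := by
  simp [dotCLM, dot3]

lemma continuous_dotCLM : Continuous dotCLM := by
  unfold dotCLM; fun_prop

lemma norm_dotCLM_le (k : V3) : ‖dotCLM k‖ ≤ 3 * ‖k‖ := by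
  refine ContinuousLinearMap.opNorm_le_bound _ (by positivity) fun x => ?_
  rw [dotCLM_apply, dot3]
  refine (norm_sum_le _ _).trans ?_
  have h : ∀ i ∈ Finset.univ, ‖k i * x i‖ ≤ ‖k‖ * ‖x‖ := fun i _ => by
    rw [norm_mul]
    exact mul_le_mul (norm_le_pi_norm k i) (norm_le_pi_norm x i) (norm_nonneg _) (norm_nonneg _)
  refine (Finset.sum_le_sum h).trans (le_of_eq ?_)
  simp [mul_assoc]

section PlaneWaves

variable {E : Type} [NormedAddCommGroup E] [NormedSpace ℂ E]

lemma norm_exp_I_mul (r : ℝ) : ‖Complex.exp (Complex.I * (r : ℂ))‖ = 1 := by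
  rw [mul_comm, Complex.norm_exp_ofReal_mul_I]

lemma integrable_exp_smul {A : V3 → E} (hA : Integrable A) {θ : V3 → ℝ} (hθ : Continuous θ) :
    Integrable (fun k => Complex.exp (Complex.I * (θ k : ℂ)) • A k) := by
  refine hA.norm.mono' (AEStronglyMeasurable.smul
    (Continuous.aestronglyMeasurable (by fun_prop)) hA.1) (Eventually.of_forall fun k => ?_)
  rw [norm_smul, norm_exp_I_mul, one_mul]

/-- An integrable continuous function whose Fourier integral is constant vanishes. -/
lemma eq_zero_of_integral_exp_dot3_eq_const [CompleteSpace E] {A : V3 → E}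
    (hA : Continuous A) (hAi : Integrable A) (C : E)
    (h : ∀ x : V3, ∫ k : V3, Complex.exp (Complex.I * (dot3 k x : ℂ)) • A k = C) (k : V3) :
    A k = 0 := by
  have hmp := PiLp.volume_preserving_ofLp (Fin 3)
  have hemb : MeasurableEmbedding (WithLp.ofLp : EuclideanSpace ℝ (Fin 3) → V3) :=
    (MeasurableEquiv.toLp 2 V3).symm.measurableEmbedding
  set B : EuclideanSpace ℝ (Fin 3) → E := fun v => A (WithLp.ofLp v) with hB
  have hBc : Continuous B := hA.comp (PiLp.continuous_ofLp 2 _)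
  have hBi : Integrable B := (hmp.integrable_comp_emb hemb).2 hAi
  have hF : ∀ w, FourierTransform.fourier B w = C := fun w => by
    rw [Real.fourier_eq', ← h ((-2 * π) • WithLp.ofLp w), ← hmp.integral_comp hemb]
    congr 1; ext v
    rw [dot3_smul_right, mul_comm Complex.I]
    congr 5
    simp [dot3, PiLp.inner_apply, mul_comm]
  have hF0 : FourierTransform.fourier B = fun _ => C := funext hF
  have hC : C = 0 := by
    have h1 := tendsto_integral_exp_inner_smul_cocompact B
    have h2 : Tendsto (FourierTransform.fourier B)
      (cocompact (EuclideanSpace ℝ (Fin 3))) (nhds 0) := h1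
    rw [hF0] at h2
    exact tendsto_nhds_unique tendsto_const_nhds h2
  have hinv := hBc.fourierInv_fourier_eq hBi (by rw [hF0, hC]; exact integrable_zero _ _ _)
  have hk := congrFun hinv (WithLp.toLp 2 k)
  rw [hF0, hC, Real.fourierInv_eq'] at hk
  simpa [hB] using hk.symm

/-- Fourier-type integrals whose phase depends affinely on a parameter are differentiable when the
amplitude has a finite first moment. -/
lemma differentiable_integral_exp_smul {H : Type} [NormedAddCommGroup H] [NormedSpace ℝ H]
    {A : V3 → E} (hA : Continuous A) (hAi : Integrable A)
    (hA1 : Integrable fun k => ‖k‖ * ‖A k‖)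
    {b : V3 → ℝ} (hb : Continuous b) {L : V3 → H →L[ℝ] ℝ} (hL : Continuous L)
    {M : ℝ} (hM : ∀ k, ‖L k‖ ≤ M * ‖k‖) :
    Differentiable ℝ
      fun y => ∫ k : V3, Complex.exp (Complex.I * ((b k + L k y : ℝ) : ℂ)) • A k := by
  intro y₀
  let D : H → V3 → H →L[ℝ] E := fun y k =>
    ((L k).smulRight (Complex.I • Complex.exp (Complex.I * ((b k + L k y : ℝ) : ℂ)) • A k))
  refine (hasFDerivAt_integral_of_dominated_of_fderiv_le (𝕜 := ℝ) (F' := D)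
    (bound := fun k => M * (‖k‖ * ‖A k‖)) (s := Set.univ) univ_mem
    (Eventually.of_forall fun y => Continuous.aestronglyMeasurable (by fun_prop)) ?_ ?_ ?_
    (hA1.const_mul M) ?_).differentiableAt
  · exact integrable_exp_smul hAi (by fun_prop)
  · refine Continuous.aestronglyMeasurable ?_
    change Continuous fun k => (ContinuousLinearMap.smulRightL ℝ H E (L k)
      (Complex.I • Complex.exp (Complex.I * ((b k + L k y₀ : ℝ) : ℂ)) • A k))
    fun_prop
  · refine Eventually.of_forall fun k y _ => ?_
    rw [ContinuousLinearMap.norm_smulRight_apply, norm_smul, norm_smul, norm_exp_I_mul,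
      Complex.norm_I, one_mul, one_mul, ← mul_assoc]
    exact mul_le_mul_of_nonneg_right (hM k) (norm_nonneg _)
  · refine Eventually.of_forall fun k y _ => ?_
    have h1 : HasFDerivAt (fun y => b k + L k y) (L k) y := (L k).hasFDerivAt.const_add _
    have h2 : HasDerivAt (fun r : ℝ => Complex.exp (Complex.I * (r : ℂ)) • A k)
        (Complex.I • Complex.exp (Complex.I * ((b k + L k y : ℝ) : ℂ)) • A k) (b k + L k y) := by
      have h3 : HasDerivAt (fun r : ℝ => Complex.exp (Complex.I * (r : ℂ)))
          (Complex.exp (Complex.I * ((b k + L k y : ℝ) : ℂ)) * (Complex.I * 1)) (b k + L k y) :=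
        ((HasDerivAt.ofReal_comp (hasDerivAt_id (b k + L k y))).const_mul Complex.I).cexp
      convert h3.smul_const (A k) using 1
      rw [smul_smul, mul_one, mul_comm]
    exact h2.hasFDerivAt.comp y h1

/-- Spatial Fourier coefficient at time `t` of a superposition of plane waves. -/
def waveCoeff (c : ℝ) (f g : V3 → E) (t : ℝ) (k : V3) : E :=
  Complex.exp (Complex.I * ((-(c * norm3 k * t) : ℝ) : ℂ)) • f k +
    Complex.exp (Complex.I * ((c * norm3 k * t : ℝ) : ℂ)) • g k

lemma waveCoeff_time_zero (c : ℝ) (f g : V3 → E) (k : V3) :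
    waveCoeff c f g 0 k = f k + g k := by
  simp [waveCoeff]

lemma continuous_waveCoeff (c : ℝ) {f g : V3 → E} (hf : Continuous f) (hg : Continuous g)
    (t : ℝ) : Continuous (waveCoeff c f g t) := by
  have := continuous_norm3
  unfold waveCoeff; fun_prop

lemma integrable_waveCoeff (c : ℝ) {f g : V3 → E} (hf : Integrable f) (hg : Integrable g)
    (t : ℝ) : Integrable (waveCoeff c f g t) := by
  have := continuous_norm3
  exact (integrable_exp_smul hf (by fun_prop)).add (integrable_exp_smul hg (by fun_prop))

lemma continuous_dot3_left (x : V3) : Continuous fun k => dot3 k x := by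
  unfold dot3; fun_prop

/-- Superposition of plane waves with values in a complex normed space. -/
def planeWave (c : ℝ) (f g : V3 → E) (t : ℝ) (x : V3) : E :=
  (∫ k : V3, Complex.exp (Complex.I * ((dot3 k x - c * norm3 k * t : ℝ) : ℂ)) • f k) +
    (∫ k : V3, Complex.exp (Complex.I * ((dot3 k x + c * norm3 k * t : ℝ) : ℂ)) • g k)

lemma pwScalar_eq_planeWave (c : ℝ) (f g : V3 → ℂ) (p : ℝ × V3) :
    pwScalar c f g p = planeWave c f g p.1 p.2 := by
  simp only [pwScalar, planeWave, smul_eq_mul, mul_comm]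

lemma planeWave_eq_integral_waveCoeff (c : ℝ) {f g : V3 → E} (hf : Integrable f)
    (hg : Integrable g) (t : ℝ) (x : V3) :
    planeWave c f g t x =
      ∫ k : V3, Complex.exp (Complex.I * (dot3 k x : ℂ)) • waveCoeff c f g t k := by
  have h1 := continuous_norm3
  have h2 := continuous_dot3_left x
  rw [planeWave, ← integral_add (integrable_exp_smul hf (by fun_prop))
    (integrable_exp_smul hg (by fun_prop))]
  congr 1; ext k
  rw [waveCoeff, smul_add, smul_smul, smul_smul, ← Complex.exp_add, ← Complex.exp_add,
    ← mul_add, ← mul_add, ← Complex.ofReal_add, ← Complex.ofReal_add, sub_eq_add_neg]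

/-- If the Fourier coefficients of a superposition of plane waves do not depend on time,
both amplitudes vanish. -/
lemma eq_zero_of_waveCoeff_const {c : ℝ} (hc : 0 < c) {f g : V3 → E} (hf : Continuous f)
    (hg : Continuous g) (h : ∀ t k, waveCoeff c f g t k = f k + g k) : f = 0 ∧ g = 0 := by
  have key : ∀ k : V3, k ≠ 0 → f k = 0 ∧ g k = 0 := fun k hk => by
    have hω : c * norm3 k ≠ 0 := (mul_pos hc (norm3_pos hk)).ne'
    have h1 := h (π / (c * norm3 k)) k
    have h2 := h (π / 2 / (c * norm3 k)) k
    have e1 : Complex.exp (Complex.I * ((π : ℝ) : ℂ)) = -1 := by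
      rw [mul_comm, Complex.exp_pi_mul_I]
    have e2 : Complex.exp (Complex.I * ((-π : ℝ) : ℂ)) = -1 := by
      rw [Complex.ofReal_neg, mul_neg, Complex.exp_neg, e1]; norm_num
    have e3 : Complex.exp (Complex.I * ((π / 2 : ℝ) : ℂ)) = Complex.I := by
      rw [mul_comm]; push_cast; exact Complex.exp_pi_div_two_mul_I
    have e4 : Complex.exp (Complex.I * ((-(π / 2) : ℝ) : ℂ)) = -Complex.I := by
      rw [Complex.ofReal_neg, mul_neg, Complex.exp_neg, e3, Complex.inv_I]
    rw [waveCoeff, mul_div_cancel₀ _ hω, e1, e2] at h1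
    rw [waveCoeff, mul_div_cancel₀ _ hω, e3, e4] at h2
    have hs : (2 : ℂ) • (f k + g k) = 0 := by
      linear_combination (norm := module) (-1 : ℂ) • h1
    have hs' : f k + g k = 0 := (smul_eq_zero.1 hs).resolve_left two_ne_zero
    have hg' : g k = -f k := by rw [← sub_eq_zero, sub_neg_eq_add, add_comm, hs']
    rw [hg'] at h2
    have hI : (-2 * Complex.I) • f k = 0 := by
      linear_combination (norm := module) h2
    have hfk : f k = 0 := (smul_eq_zero.1 hI).resolve_left (by simp)
    exact ⟨hfk, by rw [hg', hfk, neg_zero]⟩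
  have hd : Dense ({0}ᶜ : Set V3) := dense_compl_singleton 0
  exact ⟨hf.ext_on hd continuous_const fun k hk => (key k hk).1,
    hg.ext_on hd continuous_const fun k hk => (key k hk).2⟩

end PlaneWaves

section SchwartzAmplitudes

variable {E : Type} [NormedAddCommGroup E] [NormedSpace ℂ E] (c : ℝ) (f g : SchwartzMap V3 E)

lemma differentiable_planeWave_space (t : ℝ) : Differentiable ℝ (planeWave c f g t) := by
  have key : ∀ (a : ℝ) (h : SchwartzMap V3 E), Differentiable ℝ fun x =>
      ∫ k : V3, Complex.exp (Complex.I * ((a * norm3 k + dotCLM k x : ℝ) : ℂ)) • h k :=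
    fun a h => differentiable_integral_exp_smul h.continuous h.integrable
      (by simpa using h.integrable_pow_mul volume 1) (continuous_norm3.const_mul a)
      continuous_dotCLM norm_dotCLM_le
  refine (congrArg (Differentiable ℝ) (funext fun x => ?_)).mpr
    ((key (-(c * t)) f).add (key (c * t) g))
  simp only [planeWave, Pi.add_apply, dotCLM_apply]
  refine congrArg₂ (· + ·) (integral_congr_ae (Eventually.of_forall fun k => ?_))
    (integral_congr_ae (Eventually.of_forall fun k => ?_)) <;>
  · dsimp only
    congr 4
    ring

lemma differentiable_planeWave_time (x : V3) :
    Differentiable ℝ fun t => planeWave c f g t x := by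
  have key : ∀ (a : ℝ) (h : SchwartzMap V3 E), Differentiable ℝ fun t : ℝ =>
      ∫ k : V3, Complex.exp (Complex.I * ((dot3 k x +
        ((a * norm3 k) • ContinuousLinearMap.id ℝ ℝ) t : ℝ) : ℂ)) • h k := fun a h => by
    have hn := continuous_norm3
    refine differentiable_integral_exp_smul (M := |a| * 2) h.continuous h.integrable
      (by simpa using h.integrable_pow_mul volume 1) (continuous_dot3_left x)
      (by fun_prop) fun k => ?_
    rw [norm_smul, ContinuousLinearMap.norm_id, mul_one, norm_mul, Real.norm_eq_abs,
      Real.norm_eq_abs, abs_of_nonneg (norm3_nonneg k), mul_assoc]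
    gcongr
    exact norm3_le k
  refine (congrArg (Differentiable ℝ) (funext fun t => ?_)).mpr ((key (-c) f).add (key c g))
  simp only [planeWave, Pi.add_apply, smul_apply, ContinuousLinearMap.id_apply, smul_eq_mul]
  refine congrArg₂ (· + ·) (integral_congr_ae (Eventually.of_forall fun k => ?_))
    (integral_congr_ae (Eventually.of_forall fun k => ?_))
  · dsimp only
    congr 4
    ring
  · rfl

variable {c f g}

lemma planeWave_eq_zero_of_amplitudes (hf : (f : V3 → E) = 0) (hg : (g : V3 → E) = 0)
    (t : ℝ) (x : V3) : planeWave c f g t x = 0 := by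
  simp [planeWave, hf, hg]

/-- A superposition of plane waves that is spatially constant at all times vanishes. -/
lemma amplitudes_eq_zero_of_space_const [CompleteSpace E] (hc : 0 < c)
    (h : ∀ t x, planeWave c f g t x = planeWave c f g t 0) :
    (f : V3 → E) = 0 ∧ (g : V3 → E) = 0 := by
  have h0 : ∀ t k, waveCoeff c f g t k = 0 := fun t =>
    eq_zero_of_integral_exp_dot3_eq_const
      (continuous_waveCoeff c f.continuous g.continuous t)
      (integrable_waveCoeff c f.integrable g.integrable t) (planeWave c f g t 0) fun x => by
        rw [← planeWave_eq_integral_waveCoeff c f.integrable g.integrable, h]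
  refine eq_zero_of_waveCoeff_const hc f.continuous g.continuous fun t k => ?_
  rw [h0, ← waveCoeff_time_zero c, h0]

/-- A superposition of plane waves that is constant in time vanishes. -/
lemma amplitudes_eq_zero_of_time_const [CompleteSpace E] (hc : 0 < c)
    (h : ∀ t x, planeWave c f g t x = planeWave c f g 0 x) :
    (f : V3 → E) = 0 ∧ (g : V3 → E) = 0 := by
  have hi := fun t => integrable_waveCoeff c (f.integrable (μ := volume)) g.integrable t
  have hcont := fun t => continuous_waveCoeff c f.continuous g.continuous t
  refine eq_zero_of_waveCoeff_const hc f.continuous g.continuous fun t k => ?_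
  rw [← waveCoeff_time_zero c]
  refine sub_eq_zero.1 (eq_zero_of_integral_exp_dot3_eq_const
    (A := fun k => waveCoeff c f g t k - waveCoeff c f g 0 k)
    ((hcont t).sub (hcont 0)) ((hi t).sub (hi 0)) 0 (fun x => ?_) k)
  simp_rw [smul_sub]
  rw [integral_sub (integrable_exp_smul (hi t) (continuous_dot3_left x))
    (integrable_exp_smul (hi 0) (continuous_dot3_left x)),
    ← planeWave_eq_integral_waveCoeff c f.integrable g.integrable,
    ← planeWave_eq_integral_waveCoeff c f.integrable g.integrable, h, sub_self]

end SchwartzAmplitudes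

/-- A differentiable function whose radial derivative vanishes is constant. -/
lemma eq_apply_zero_of_fderiv_apply_self_eq_zero {H E : Type*} [NormedAddCommGroup H]
    [NormedSpace ℝ H] [NormedAddCommGroup E] [NormedSpace ℝ E] {φ : H → E}
    (hφ : Differentiable ℝ φ) (h : ∀ x, fderiv ℝ φ x x = 0) (x : H) : φ x = φ 0 := by
  have hd : ∀ s : ℝ, HasDerivAt (fun s : ℝ => φ ((1 - s) • x)) (fderiv ℝ φ ((1 - s) • x) (-x)) s :=
    fun s => (hφ _).hasFDerivAt.comp_hasDerivAt s
      (by simpa using ((hasDerivAt_id s).const_sub 1).smul_const x)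
  have hz : ∀ s : ℝ, s < 1 → fderiv ℝ φ ((1 - s) • x) (-x) = 0 := fun s hs => by
    have h1 := h ((1 - s) • x)
    rw [map_smul] at h1
    rw [map_neg, (smul_eq_zero.1 h1).resolve_left (by linarith), neg_zero]
  have hcst := constant_of_has_deriv_right_zero (f := fun s : ℝ => φ ((1 - s) • x))
    (a := 0) (b := 1) (fun s _ => (hd s).continuousAt.continuousWithinAt)
    (fun s hs => hz s hs.2 ▸ (hd s).hasDerivWithinAt) 1 (by simp)
  simpa using hcst.symm

/-- a plane-wave charge/current pair with Schwartz coefficients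
satisfying the continuity equation, `∇ρ + (1/c²)∂J/∂t = 0`, and tangentiality
`x·J(t,x) = 0` is trivial: `f = g = 0`, `F = G = 0`, `ρ = 0`, `J = 0`. -/
theorem stmt_17 (c : ℝ) (hc : 0 < c)
    (f g : SchwartzMap V3 ℂ) (F G : SchwartzMap V3 (Fin 3 → ℂ))
    (hcont : ∀ p : ℝ × V3, ptd (pwScalar c f g) p + divgC (pwVec c F G) p = 0)
    (hrel : ∀ p : ℝ × V3,
      gradC (pwScalar c f g) p + ((c : ℂ) ^ 2)⁻¹ • ptd (pwVec c F G) p = 0)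
    (htang : ∀ p : ℝ × V3, ∑ i : Fin 3, (p.2 i : ℂ) * pwVec c F G p i = 0) :
    (∀ k : V3, f k = 0) ∧ (∀ k : V3, g k = 0) ∧
    (∀ k : V3, F k = 0) ∧ (∀ k : V3, G k = 0) ∧
    (∀ p : ℝ × V3, pwScalar c f g p = 0) ∧
    (∀ p : ℝ × V3, pwVec c F G p = 0) := by
  have hJ : ∀ p, pwVec c F G p = planeWave c F G p.1 p.2 := fun _ => rfl
  have hρ : ∀ p, pwScalar c f g p = planeWave c f g p.1 p.2 := pwScalar_eq_planeWave c f g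
  have hc2 : ((c : ℂ) ^ 2)⁻¹ ≠ 0 := by simp [hc.ne']
  have hrad : ∀ t x, fderiv ℝ (planeWave c f g t) x x = 0 := fun t x => by
    have hgrad : ∀ i, fderiv ℝ (planeWave c f g t) x (Pi.single i 1) =
        -(((c : ℂ) ^ 2)⁻¹ * deriv (fun s => planeWave c F G s x i) t) := fun i => by
      have h1 := congrFun (hrel (t, x)) i
      simp only [gradC, pxd, ptd, hρ, hJ, Pi.add_apply, Pi.smul_apply, smul_eq_mul,
        Pi.zero_apply] at h1
      rw [deriv_pi (fun j => (differentiable_pi.1 (differentiable_planeWave_time c F G x) j) t)]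
        at h1
      exact eq_neg_of_add_eq_zero_left h1
    have hsum : ∑ i, (x i : ℂ) * deriv (fun s => planeWave c F G s x i) t = 0 := by
      have h2 : (fun s => ∑ i, (x i : ℂ) * planeWave c F G s x i) = fun _ => 0 :=
        funext fun s => htang (s, x)
      have h3 : HasDerivAt (fun s => ∑ i, (x i : ℂ) * planeWave c F G s x i)
          (∑ i, (x i : ℂ) * deriv (fun s => planeWave c F G s x i) t) t :=
        HasDerivAt.fun_sum fun i _ => ((differentiable_pi.1
          (differentiable_planeWave_time c F G x) i) t).hasDerivAt.const_mul _
      rw [← h3.deriv, h2, deriv_const]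
    have hx := congrArg (fderiv ℝ (planeWave c f g t) x) (pi_eq_sum_univ' x)
    rw [hx, map_sum]
    calc ∑ i, fderiv ℝ (planeWave c f g t) x (x i • Pi.single i (1 : ℝ))
        = ∑ i, -((c : ℂ) ^ 2)⁻¹ * ((x i : ℂ) * deriv (fun s => planeWave c F G s x i) t) := by
          refine Finset.sum_congr rfl fun i _ => ?_
          rw [map_smul, hgrad, Complex.real_smul]
          ring
      _ = 0 := by rw [← Finset.mul_sum, hsum, mul_zero]
  obtain ⟨hf, hg⟩ := amplitudes_eq_zero_of_space_const hc fun t x =>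
    eq_apply_zero_of_fderiv_apply_self_eq_zero (differentiable_planeWave_space c f g t) (hrad t) x
  have hρ0 : ∀ p, pwScalar c f g p = 0 := fun p => by
    rw [hρ, planeWave_eq_zero_of_amplitudes hf hg]
  have hJt : ∀ t x, deriv (fun s => planeWave c F G s x) t = 0 := fun t x => by
    have h1 := hrel (t, x)
    have h2 : gradC (pwScalar c f g) (t, x) = 0 := by
      ext i; simp [gradC, pxd, hρ0]
    rw [h2, zero_add] at h1
    exact (smul_eq_zero.1 h1).resolve_left hc2
  obtain ⟨hF, hG⟩ := amplitudes_eq_zero_of_time_const hc fun t x =>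
    is_const_of_deriv_eq_zero (differentiable_planeWave_time c F G x) (fun t => hJt t x) t 0
  exact ⟨congrFun hf, congrFun hg, congrFun hF, congrFun hG, hρ0, fun p => by
    rw [hJ, planeWave_eq_zero_of_amplitudes hF hG]⟩
end
end
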